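/- arXiv:2002.02541 — 2 statements merged into one kernel-verified Lean document; each statement's English description precedes it below -/
import Mathlib

section
/- There exists a subset A ⊆ ℤ that is recursive and closed in the profinite topology on ℤ, but for which the function n ↦ (A mod n) is NOT computable. -/
namespace CFQ

theorem primrec_factorial : Primrec Nat.factorial := by
  have h : Primrec fun n : ℕ =>
      Nat.rec (motive := fun _ => ℕ) 1 (fun m ih => (m + 1) * ih) n :=
    Primrec.nat_rec₁ 1
      (Primrec.nat_mul.comp (Primrec.succ.comp Primrec.fst) Primrec.snd)
  refine h.of_eq fun n => ?_
  induction n with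
  | zero => rfl
  | succ n ih =>
    show (n + 1) * (Nat.rec (motive := fun _ => ℕ) 1 (fun m ih => (m + 1) * ih) n)
        = (n + 1).factorial
    rw [ih, Nat.factorial_succ]

theorem primrec_pow_const : ∀ k : ℕ, Primrec fun n : ℕ => n ^ k
  | 0 => (Primrec.const 1).of_eq fun n => (pow_zero n).symm
  | k + 1 => (Primrec.nat_mul.comp (primrec_pow_const k) Primrec.id).of_eq
      fun n => (pow_succ n k).symm

/-- A `Primcodable` structure on the type of pairs of a natural number `n` and a
`k`-tuple of permutations of `Fin n`. -/
noncomputable instance sigmaPermPrimcodable (k : ℕ) :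
    Primcodable (Σ n : ℕ, Fin k → Equiv.Perm (Fin n)) :=
  letI : Primcodable {m : ℕ // m.unpair.2 < m.unpair.1.factorial ^ k} :=
    Primcodable.subtype
      (Primrec.nat_lt.comp (Primrec.snd.comp Primrec.unpair)
        ((primrec_pow_const k).comp (primrec_factorial.comp (Primrec.fst.comp Primrec.unpair))))
  Primcodable.ofEquiv {m : ℕ // m.unpair.2 < m.unpair.1.factorial ^ k} <|
    (Equiv.sigmaCongrRight fun n =>
      (Fintype.equivFinOfCardEq
        (by simp [Fintype.card_fun, Fintype.card_perm]) :
          (Fin k → Equiv.Perm (Fin n)) ≃ Fin (n.factorial ^ k))).trans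
    { toFun := fun p => ⟨Nat.pair p.1 p.2, by simp⟩
      invFun := fun m => ⟨m.1.unpair.1, ⟨m.1.unpair.2, m.2⟩⟩
      left_inv := fun p => by
        rcases p with ⟨n, i⟩
        refine Sigma.ext (by simp) ?_
        rw [Fin.heq_ext_iff (by simp)]
        simp
      right_inv := fun m => by
        apply Subtype.ext
        simp }

/-- The extension predicate of a marked group. -/
def ExtPred {k : ℕ} {G : Type*} [Group G] (s : Fin k → G)
    (p : Σ n : ℕ, Fin k → Equiv.Perm (Fin n)) : Prop :=
  ∃ φ : G →* Equiv.Perm (Fin p.1), ∀ i, φ (s i) = p.2 i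

/-- The word problem of a marked group. -/
def WordProb {k : ℕ} {G : Type*} [Group G] (s : Fin k → G)
    (w : List (Fin k × Bool)) : Prop :=
  FreeGroup.lift s (FreeGroup.mk w) = 1

/-- A predicate is recursively enumerable if it is the domain of a partial
computable function. -/
def RePred {α : Type*} [Primcodable α] (p : α → Prop) : Prop :=
  ∃ f : α →. Unit, Partrec f ∧ ∀ a, p a ↔ (f a).Dom

/-- A group is residually finite if every nontrivial element has nontrivial
image in some finite quotient (equivalently, some symmetric group). -/
def ResiduallyFinite (G : Type*) [Group G] : Prop :=
  ∀ g : G, g ≠ 1 → ∃ (n : ℕ) (φ : G →* Equiv.Perm (Fin n)), φ g ≠ 1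

/-- A subset of `ℤ` is closed in the profinite topology on `ℤ` if every point of
its complement is contained in an arithmetic progression avoiding the set. -/
def ProfiniteClosed (A : Set ℤ) : Prop :=
  ∀ x : ℤ, x ∉ A → ∃ b : ℤ, 1 ≤ b ∧ ∀ k : ℤ, x + b * k ∉ A

/-- The function `n ↦ (A mod n)` is computable. -/
def ModFunComputable (A : Set ℤ) : Prop :=
  ComputablePred fun p : ℕ × ℤ => 1 ≤ p.1 ∧ ∃ a ∈ A, a ≡ p.2 [ZMOD (p.1 : ℤ)]

open Nat.Partrec (Code)
open Encodable Denumerable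

theorem encode_intCast (n : ℕ) : encode (n : ℤ) = 2 * n := rfl

theorem primrec_intCast : Primrec fun n : ℕ => (n : ℤ) :=
  Primrec.encode_iff.1 <|
    (Primrec.nat_mul.comp (Primrec.const 2) Primrec.id).of_eq fun n => (encode_intCast n).symm

theorem primrec_two_pow : Primrec fun n : ℕ => 2 ^ n := by
  have h : Primrec₂ ((· ^ ·) : ℕ → ℕ → ℕ) := Primrec₂.unpaired'.1 Nat.Primrec.pow
  exact h.comp (Primrec.const 2) Primrec.id

/-- `Nat.pair e t` satisfies this predicate if the `e`-th program, run on input `0`, halts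
after exactly `t + 1` steps. -/
def HaltsFirstAt (q : ℕ) : Prop :=
  Code.evaln (q.unpair.2 + 1) (ofNat Code q.unpair.1) 0 ≠ none ∧
    Code.evaln q.unpair.2 (ofNat Code q.unpair.1) 0 = none

theorem primrecPred_haltsFirstAt : PrimrecPred HaltsFirstAt := by
  have hc : Primrec fun q : ℕ => ofNat Code q.unpair.1 :=
    (Primrec.ofNat Code).comp (Primrec.fst.comp Primrec.unpair)
  have ht : Primrec fun q : ℕ => q.unpair.2 := Primrec.snd.comp Primrec.unpair
  have hev {g : ℕ → ℕ} (hg : Primrec g) :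
      PrimrecPred fun q : ℕ => Code.evaln (g q) (ofNat Code q.unpair.1) 0 = none :=
    Primrec.eq.comp (Code.primrec_evaln.comp ((hg.pair hc).pair (Primrec.const 0)))
      (Primrec.const none)
  exact (hev (Primrec.succ.comp ht)).not.and (hev ht)

theorem evaln_eq_none_of_le {c : Code} {s t n : ℕ} (hst : s ≤ t) (h : Code.evaln t c n = none) :
    Code.evaln s c n = none := by
  rw [Option.eq_none_iff_forall_not_mem] at h ⊢
  exact fun x hx => h x (Code.evaln_mono hst hx)

theorem HaltsFirstAt.eq_of_unpair_fst_eq {p q : ℕ} (hp : HaltsFirstAt p) (hq : HaltsFirstAt q)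
    (h : p.unpair.1 = q.unpair.1) : p = q := by
  obtain ⟨hp₁, hp₂⟩ := hp
  obtain ⟨hq₁, hq₂⟩ := hq
  rw [h] at hp₁ hp₂
  have ht : p.unpair.2 = q.unpair.2 := by
    rcases lt_trichotomy p.unpair.2 q.unpair.2 with hlt | heq | hlt
    · exact absurd (evaln_eq_none_of_le hlt hq₂) hp₁
    · exact heq
    · exact absurd (evaln_eq_none_of_le hlt hp₂) hq₁
  rw [← Nat.pair_unpair p, h, ht, Nat.pair_unpair]

theorem exists_haltsFirstAt_iff (c : Code) :
    (∃ q, HaltsFirstAt q ∧ q.unpair.1 = encode c) ↔ (Code.eval c 0).Dom := by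
  constructor
  · rintro ⟨q, ⟨hq, -⟩, hc⟩
    rw [hc, ofNat_encode] at hq
    obtain ⟨x, hx⟩ := Option.ne_none_iff_exists'.1 hq
    exact Part.dom_iff_mem.2 ⟨x, Code.evaln_sound hx⟩
  · intro h
    obtain ⟨x, hx⟩ := Part.dom_iff_mem.1 h
    obtain ⟨k, hk⟩ := Code.evaln_complete.1 hx
    have hex : ∃ k, Code.evaln k c 0 ≠ none :=
      ⟨k, Option.ne_none_iff_exists'.2 ⟨x, hk⟩⟩
    classical
    obtain ⟨t, ht⟩ : ∃ t, Nat.find hex = t + 1 := by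
      refine Nat.exists_eq_succ_of_ne_zero fun h0 => ?_
      have := Nat.find_spec hex
      rw [h0] at this
      simp [Code.evaln] at this
    refine ⟨Nat.pair (encode c) t, ⟨?_, ?_⟩, by simp⟩
    · simpa [ht] using Nat.find_spec hex
    · simpa using Nat.find_min hex (m := t) (by omega)

/-- An injective encoding of `q = Nat.pair e t` by a natural number of `2`-adic valuation `e`. -/
def valCode (q : ℕ) : ℕ := 2 ^ q.unpair.1 * (2 * q + 1)

theorem primrec_valCode : Primrec valCode :=
  Primrec.nat_mul.comp (primrec_two_pow.comp (Primrec.fst.comp Primrec.unpair))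
    (Primrec.nat_double_succ)

theorem lt_two_mul_valCode (q : ℕ) : q < 2 * valCode q := by
  have : 1 * (2 * q + 1) ≤ valCode q := Nat.mul_le_mul_right _ Nat.one_le_two_pow
  omega

theorem eq_of_two_pow_succ_dvd_sub {d e : ℕ} {u v : ℤ} (hu : Odd u) (hv : Odd v)
    (h : (2 : ℤ) ^ (d + 1) ∣ 2 ^ e * u - 2 ^ d * v) : e = d := by
  have key : ∀ {k : ℕ} {w : ℤ}, Odd w → ¬ (2 : ℤ) ^ (k + 1) ∣ 2 ^ k * w := by
    intro k w hw hdvd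
    rw [pow_succ] at hdvd
    exact (Int.not_even_iff_odd.2 hw)
      (even_iff_two_dvd.2 (Int.dvd_of_mul_dvd_mul_left (by positivity) hdvd))
  rcases lt_trichotomy e d with hlt | heq | hlt
  · refine absurd ?_ (key hu (k := e))
    refine (dvd_sub_left (Dvd.dvd.mul_right (pow_dvd_pow 2 hlt) v)).1 ?_
    exact (pow_dvd_pow 2 (by omega)).trans h
  · exact heq
  · exact absurd ((dvd_sub_right (Dvd.dvd.mul_right (pow_dvd_pow 2 hlt) u)).1 h) (key hv)

theorem unpair_fst_eq_of_two_pow_succ_dvd {d q : ℕ} {v : ℤ} (hv : Odd v)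
    (h : (2 : ℤ) ^ (d + 1) ∣ valCode q - 2 ^ d * v) : q.unpair.1 = d := by
  refine eq_of_two_pow_succ_dvd_sub (u := 2 * q + 1) ⟨q, rfl⟩ hv ?_
  simpa [valCode] using h

/-- The integer `0` together with the codes of all first halting times. -/
def haltingSet : Set ℤ := {x | x = 0 ∨ ∃ q, HaltsFirstAt q ∧ (valCode q : ℤ) = x}

theorem computablePred_mem_haltingSet : ComputablePred fun x : ℤ => x ∈ haltingSet := by
  have hR : PrimrecRel fun q y : ℕ => HaltsFirstAt q ∧ 2 * valCode q = y :=
    (primrecPred_haltsFirstAt.comp Primrec.fst).and <|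
      Primrec.eq.comp (Primrec.nat_double.comp (primrec_valCode.comp Primrec.fst)) Primrec.snd
  have h : PrimrecPred fun x : ℤ =>
      x = 0 ∨ ∃ q < encode x, HaltsFirstAt q ∧ 2 * valCode q = encode x :=
    (Primrec.eq.comp Primrec.id (Primrec.const 0)).or
      (hR.exists_lt.comp Primrec.encode Primrec.encode)
  obtain ⟨inst, hdec⟩ := h
  refine ComputablePred.of_eq ⟨inst, hdec.to_comp⟩ fun x => or_congr_right ?_
  constructor
  · rintro ⟨q, -, hq, hx⟩
    exact ⟨q, hq, encode_injective ((encode_intCast _).trans hx)⟩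
  · rintro ⟨q, hq, rfl⟩
    exact ⟨q, lt_two_mul_valCode q, hq, rfl⟩

theorem profiniteClosed_haltingSet : ProfiniteClosed haltingSet := by
  intro x hx
  have hx0 : x ≠ 0 := fun h => hx (Or.inl h)
  obtain ⟨d, v, hv, rfl⟩ : ∃ (d : ℕ) (v : ℤ), Odd v ∧ x = 2 ^ d * v := by
    have hfin : FiniteMultiplicity (2 : ℤ) x := Int.finiteMultiplicity_iff.2 ⟨by decide, hx0⟩
    obtain ⟨v, h, hv⟩ := hfin.exists_eq_pow_mul_and_not_dvd
    exact ⟨_, v, Int.not_even_iff_odd.1 (even_iff_two_dvd.not.2 hv), h⟩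
  have hzero (c k : ℤ) : 2 ^ d * v + 2 ^ (d + 1) * c * k ≠ 0 := by
    intro h
    have h2 : (2 : ℤ) ^ d * (v + 2 * (c * k)) = 0 := by rw [← h]; ring
    obtain ⟨w, rfl⟩ := hv
    have := (mul_eq_zero.1 h2).resolve_left (by positivity)
    omega
  have hval (c k : ℤ) (q : ℕ) (h : (valCode q : ℤ) = 2 ^ d * v + 2 ^ (d + 1) * c * k) :
      q.unpair.1 = d :=
    unpair_fst_eq_of_two_pow_succ_dvd hv ⟨c * k, by rw [h]; ring⟩
  by_cases hex : ∃ q, HaltsFirstAt q ∧ q.unpair.1 = d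
  · obtain ⟨q, hq, hqd⟩ := hex
    have hne : (valCode q : ℤ) - 2 ^ d * v ≠ 0 := fun h => hx (Or.inr ⟨q, hq, by omega⟩)
    refine ⟨2 ^ (d + 1) * (2 * |(valCode q : ℤ) - 2 ^ d * v|), ?_, fun k hk => ?_⟩
    · have := abs_pos.2 hne
      exact Order.one_le_iff_pos.2 (by positivity)
    · rcases hk with hk | ⟨p, hp, hpx⟩
      · exact hzero _ _ hk
      · obtain rfl := hp.eq_of_unpair_fst_eq hq ((hval _ _ p hpx).trans hqd.symm)
        have hdvd : 2 * |(valCode p : ℤ) - 2 ^ d * v| ∣ (valCode p : ℤ) - 2 ^ d * v :=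
          ⟨2 ^ (d + 1) * k, by linear_combination hpx⟩
        have := Int.le_of_dvd (abs_pos.2 hne) ((dvd_abs _ _).2 hdvd)
        have := abs_pos.2 hne
        omega
  · refine ⟨2 ^ (d + 1) * 1, Order.one_le_iff_pos.2 (by positivity), fun k hk => ?_⟩
    rcases hk with hk | ⟨p, hp, hpx⟩
    · exact hzero _ _ hk
    · exact hex ⟨p, hp, hval _ _ p hpx⟩

theorem exists_mem_haltingSet_modEq_iff (d : ℕ) :
    (∃ a ∈ haltingSet, a ≡ 2 ^ d [ZMOD 2 ^ (d + 1)]) ↔ ∃ q, HaltsFirstAt q ∧ q.unpair.1 = d := by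
  constructor
  · rintro ⟨a, rfl | ⟨q, hq, rfl⟩, ha⟩
    · have h : (2 : ℤ) ^ (d + 1) ∣ 2 ^ d := by simpa using ha.dvd
      have := (pow_dvd_pow_iff two_ne_zero (by decide)).1 h
      omega
    · exact ⟨q, hq, unpair_fst_eq_of_two_pow_succ_dvd odd_one (by simpa using ha.symm.dvd)⟩
  · rintro ⟨q, hq, rfl⟩
    refine ⟨valCode q, Or.inr ⟨q, hq, rfl⟩, (Int.modEq_iff_dvd.2 ⟨q, ?_⟩).symm⟩
    simp only [valCode]
    push_cast
    ring

theorem not_modFunComputable_haltingSet : ¬ ModFunComputable haltingSet := by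
  intro h
  refine ComputablePred.halting_problem 0 (ComputablePred.computable_of_manyOneReducible ?_ h)
  have hpow : Primrec fun c : Code => 2 ^ encode c := primrec_two_pow.comp Primrec.encode
  refine ⟨fun c => (2 ^ (encode c + 1), ((2 ^ encode c : ℕ) : ℤ)),
    ((primrec_two_pow.comp (Primrec.succ.comp Primrec.encode)).pair
      (primrec_intCast.comp hpow)).to_comp, fun c => ?_⟩
  refine (exists_haltsFirstAt_iff c).symm.trans ?_
  rw [← exists_mem_haltingSet_modEq_iff]
  simp [Nat.one_le_two_pow]

/-- There is a recursive subset of `ℤ`, closed in the profinite topology on `ℤ`,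
for which `n ↦ (A mod n)` is not computable. -/
theorem statement_2 :
    ∃ A : Set ℤ,
      ComputablePred (fun x : ℤ => x ∈ A) ∧
      ProfiniteClosed A ∧
      ¬ ModFunComputable A :=
  ⟨haltingSet, computablePred_mem_haltingSet, profiniteClosed_haltingSet,
    not_modFunComputable_haltingSet⟩

end CFQ
end

section
/- There exists a subset A ⊆ ℤ that is not recursive, is closed in the profinite topology on ℤ, and for which the function n ↦ (A mod n) is computable. -/
namespace CFQ

open Nat.Partrec (Code)

theorem primrec_int_natCast : Primrec (Nat.cast : ℕ → ℤ) :=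
  Primrec.encode_iff.1 (Primrec.nat_double.of_eq fun _ => rfl)

theorem primrec_int_emod_toNat :
    Primrec fun p : ℕ × ℤ => (p.2 % (p.1 + 1 : ℕ)).toNat := by
  have h : Primrec fun p : ℕ × ℤ => bif (Encodable.encode p.2).bodd
      then p.1 - (Encodable.encode p.2).div2 % (p.1 + 1)
      else (Encodable.encode p.2).div2 % (p.1 + 1) := by
    have he : Primrec fun p : ℕ × ℤ => Encodable.encode p.2 :=
      Primrec.encode.comp Primrec.snd
    have hm : Primrec fun p : ℕ × ℤ => (Encodable.encode p.2).div2 % (p.1 + 1) :=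
      Primrec.nat_mod.comp (Primrec.nat_div2.comp he) (Primrec.succ.comp Primrec.fst)
    exact Primrec.cond (Primrec.nat_bodd.comp he)
      (Primrec.nat_sub.comp Primrec.fst hm) hm
  refine h.of_eq fun p => ?_
  obtain ⟨n, m | m⟩ := p
  · have : Encodable.encode (Int.ofNat m) = 2 * m := rfl
    simp only [this]
    simp [Nat.div2_val]
    norm_cast
  · have : Encodable.encode (Int.negSucc m) = 2 * m + 1 := rfl
    simp only [this]
    have h2 : (2 * m + 1) / 2 = m := by omega
    have h3 : ((m : ℤ) % ((n + 1 : ℕ) : ℤ)) = ((m % (n + 1) : ℕ) : ℤ) := rfl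
    rw [Int.negSucc_emod _ (by omega), h3]
    have h4 : (2 * m + 1).bodd = true := by simp
    simp only [Nat.div2_val, h2, h4, cond_true]
    omega

/-- The set consisting of `0` and of a sequence of integers converging to `0` in the profinite
topology is closed. -/
theorem profiniteClosed_insert_zero_range {a : ℕ → ℤ}
    (ha : ∀ n c : ℕ, n ≤ c → ((n + 1 : ℕ) : ℤ) ∣ a c) : ProfiniteClosed (insert 0 (Set.range a)) := by
  intro x hx
  have hx0 : x ≠ 0 := fun h => hx (Or.inl h)
  have hxa : ∀ c, x - a c ≠ 0 := fun c h => hx (Or.inr ⟨c, by omega⟩)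
  have key : ∀ y : ℤ, ((y.natAbs + 1 : ℕ) : ℤ) ∣ y → y = 0 := fun y h =>
    Int.eq_zero_of_dvd_of_natAbs_lt_natAbs h (by omega)
  obtain ⟨b, hb⟩ : ∃ b : ℕ,
      b = (x.natAbs + 1) * ∏ c ∈ Finset.range x.natAbs, ((x - a c).natAbs + 1) := ⟨_, rfl⟩
  have hb_pos : 0 < b := hb ▸ by positivity
  refine ⟨b, by omega, fun k hk => ?_⟩
  have hdvd : ∀ y : ℤ, x + b * k = y → ((x.natAbs + 1 : ℕ) : ℤ) ∣ x - y := by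
    rintro y rfl
    rw [sub_add_cancel_left, dvd_neg]
    exact (Int.natCast_dvd_natCast.2 (Dvd.intro _ hb.symm)).mul_right k
  rcases hk with hk | ⟨c, hc⟩
  · exact hx0 (key x (by simpa using hdvd 0 hk))
  · rcases lt_or_ge c x.natAbs with hlt | hge
    · refine hxa c (key _ ?_)
      have hbc : (x - a c).natAbs + 1 ∣ b := hb ▸ (Finset.dvd_prod_of_mem (fun c => (x - a c).natAbs + 1)
        (Finset.mem_range.2 hlt)).mul_left _
      have hk : x - a c = -(b * k) := by rw [hc, sub_add_cancel_left]
      nth_rw 2 [hk]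
      rw [dvd_neg]
      exact (Int.natCast_dvd_natCast.2 hbc).mul_right k
    · exact hx0 (key x ((dvd_sub_left (ha _ c hge)).1 (hdvd _ hc.symm)))

/-- If a sequence of integers converges to `0` in the profinite topology with an explicit modulus,
and its residues are uniformly primitive recursive, then the set formed by its terms and `0` has
computable images modulo every `n`. -/
theorem modFunComputable_insert_zero_range {a : ℕ → ℤ} {f : ℕ → ℕ → ℕ} (hf : Primrec₂ f)
    (ha : ∀ n c : ℕ, n ≤ c → ((n + 1 : ℕ) : ℤ) ∣ a c)
    (hfa : ∀ n c : ℕ, a c ≡ f n c [ZMOD (n + 1 : ℕ)]) :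
    ModFunComputable (insert 0 (Set.range a)) := by
  have hR : PrimrecRel fun (c : ℕ) (q : ℕ × ℕ) => f q.1 c % (q.1 + 1) = q.2 :=
    Primrec.eq.comp
      (Primrec.nat_mod.comp (hf.comp (Primrec.fst.comp Primrec.snd) Primrec.fst)
        (Primrec.succ.comp (Primrec.fst.comp Primrec.snd)))
      (Primrec.snd.comp Primrec.snd)
  have hE : PrimrecRel fun (m : ℕ) (q : ℕ × ℕ) => ∃ c < m, f q.1 c % (q.1 + 1) = q.2 :=
    (hR.exists_mem_list.comp (Primrec.list_range.comp Primrec.fst) Primrec.snd).of_eq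
      fun _ => by simp
  have hn : Primrec fun p : ℕ × ℤ => p.1 - 1 := Primrec.pred.comp Primrec.fst
  have hr : Primrec fun p : ℕ × ℤ => (p.2 % (p.1 - 1 + 1 : ℕ)).toNat :=
    primrec_int_emod_toNat.comp (Primrec.pair hn Primrec.snd)
  have h : PrimrecPred fun p : ℕ × ℤ => 1 ≤ p.1 ∧ ((p.2 % (p.1 - 1 + 1 : ℕ)).toNat = 0 ∨
      ∃ c < p.1, f (p.1 - 1) c % (p.1 - 1 + 1) = (p.2 % (p.1 - 1 + 1 : ℕ)).toNat) :=
    (Primrec.nat_le.comp (Primrec.const 1) Primrec.fst).and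
      ((Primrec.eq.comp hr (Primrec.const 0)).or
        (hE.comp Primrec.fst (Primrec.pair hn hr)))
  refine ComputablePred.of_eq (PrimrecPred.computablePred h) ?_
  rintro ⟨n, r⟩
  refine and_congr_right fun hn => ?_
  obtain ⟨n, rfl⟩ : ∃ m, n = m + 1 := ⟨n - 1, by simp at hn; omega⟩
  have hpos : 0 ≤ r % (n + 1 : ℕ) := Int.emod_nonneg _ (by omega)
  simp only [Nat.add_sub_cancel, Set.mem_insert_iff, Set.mem_range, exists_eq_or_imp,
    exists_exists_eq_and]
  have hmod : ∀ c, f n c % (n + 1) = (r % (n + 1 : ℕ)).toNat ↔ a c ≡ r [ZMOD (n + 1 : ℕ)] := by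
    intro c
    rw [Int.ModEq, hfa n c]
    omega
  have hzero : (r % (n + 1 : ℕ)).toNat = 0 ↔ 0 ≡ r [ZMOD (n + 1 : ℕ)] := by
    rw [Int.ModEq]
    simp only [Int.zero_emod]
    omega
  simp only [hmod, hzero]
  refine ⟨?_, ?_⟩
  · rintro (h | ⟨c, -, h⟩)
    exacts [Or.inl h, Or.inr ⟨c, h⟩]
  · rintro (h | ⟨c, h⟩)
    · exact Or.inl h
    · rcases lt_or_ge c n with hlt | hge
      · exact Or.inr ⟨c, hlt.trans n.lt_succ_self, h⟩
      · exact Or.inl (((Int.modEq_zero_iff_dvd.2 (ha _ c hge)).symm).trans h)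

/-- The code with index `c`, run on input `0`, halts at stage `s + 1` but not at stage `s`. -/
def HaltsAt (c s : ℕ) : Prop :=
  (Code.evaln (s + 1) (Denumerable.ofNat Code c) 0).isSome = true ∧
    (Code.evaln s (Denumerable.ofNat Code c) 0).isSome = false

instance : DecidableRel HaltsAt := fun _ _ => inferInstanceAs (Decidable (_ ∧ _))

theorem primrecRel_haltsAt : PrimrecRel HaltsAt := by
  have h : Primrec fun p : ℕ × ℕ =>
      (Code.evaln p.2 (Denumerable.ofNat Code p.1) 0).isSome :=
    Primrec.option_isSome.comp (Code.primrec_evaln.comp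
      (Primrec.pair (Primrec.pair Primrec.snd ((Primrec.ofNat Code).comp Primrec.fst))
        (Primrec.const 0)))
  exact PrimrecPred.and
    (Primrec.eq.comp (h.comp (Primrec.pair Primrec.fst (Primrec.succ.comp Primrec.snd)))
      (Primrec.const true))
    (Primrec.eq.comp h (Primrec.const false))

theorem evaln_isSome_mono {c : Code} {s t : ℕ} (hst : s ≤ t)
    (h : (Code.evaln s c 0).isSome = true) : (Code.evaln t c 0).isSome = true := by
  obtain ⟨x, hx⟩ := Option.isSome_iff_exists.1 h
  exact Option.isSome_iff_exists.2 ⟨x, Code.evaln_mono hst hx⟩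

theorem HaltsAt.unique {c s t : ℕ} (hs : HaltsAt c s) (ht : HaltsAt c t) : s = t := by
  by_contra hne
  rcases lt_or_gt_of_ne hne with h | h
  · exact absurd (evaln_isSome_mono h hs.1) (by simp [ht.2])
  · exact absurd (evaln_isSome_mono h ht.1) (by simp [hs.2])

theorem exists_haltsAt_iff (c : ℕ) :
    (∃ s, HaltsAt c s) ↔ ((Denumerable.ofNat Code c).eval 0).Dom := by
  constructor
  · rintro ⟨s, hs, -⟩
    obtain ⟨x, hx⟩ := Option.isSome_iff_exists.1 hs
    exact Part.dom_iff_mem.2 ⟨x, Code.evaln_sound hx⟩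
  · intro h
    obtain ⟨x, hx⟩ := Part.dom_iff_mem.1 h
    obtain ⟨k, hk⟩ := Code.evaln_complete.1 hx
    have hk' := Option.isSome_iff_exists.2 ⟨x, hk⟩
    clear hk
    induction k with
    | zero => simp [Code.evaln] at hk'
    | succ k ih =>
      by_cases hs : (Code.evaln k (Denumerable.ofNat Code c) 0).isSome = true
      · exact ih hs
      · exact ⟨k, hk', by simpa using hs⟩

open Classical in
/-- The sequence whose `c`-th term is `(c + 1)!`, shifted to a negative number by a highly
divisible amount if the `c`-th code halts. -/
noncomputable def haltingSeq (c : ℕ) : ℤ :=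
  if h : ∃ s, HaltsAt c s then ((c + 1).factorial : ℤ) - (c + h.choose + 2).factorial
  else (c + 1).factorial

theorem haltingSeq_of_haltsAt {c s : ℕ} (h : HaltsAt c s) :
    haltingSeq c = ((c + 1).factorial : ℤ) - (c + s + 2).factorial := by
  have hex : ∃ s, HaltsAt c s := ⟨s, h⟩
  rw [haltingSeq, dif_pos hex, hex.choose_spec.unique h]

theorem haltingSeq_of_not_exists {c : ℕ} (h : ¬ ∃ s, HaltsAt c s) :
    haltingSeq c = (c + 1).factorial :=
  dif_neg h

theorem natCast_dvd_factorial {n m : ℕ} (hn : 0 < n) (h : n ≤ m) : (n : ℤ) ∣ m.factorial :=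
  Int.natCast_dvd_natCast.2 (Nat.dvd_factorial hn h)

theorem natCast_dvd_haltingSeq (n c : ℕ) (h : n ≤ c) :
    ((n + 1 : ℕ) : ℤ) ∣ haltingSeq c := by
  by_cases hc : ∃ s, HaltsAt c s
  · obtain ⟨s, hs⟩ := hc
    rw [haltingSeq_of_haltsAt hs]
    exact dvd_sub (natCast_dvd_factorial n.succ_pos (by omega))
      (natCast_dvd_factorial n.succ_pos (by omega))
  · rw [haltingSeq_of_not_exists hc]
    exact natCast_dvd_factorial n.succ_pos (by omega)

theorem factorial_mem_iff (c : ℕ) :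
    ((c + 1).factorial : ℤ) ∈ insert 0 (Set.range haltingSeq) ↔ ¬ ∃ s, HaltsAt c s := by
  constructor
  · rintro (h | ⟨d, hd⟩) ⟨s, hs⟩
    · exact Nat.factorial_ne_zero _ (by exact_mod_cast h)
    · by_cases hex : ∃ t, HaltsAt d t
      · obtain ⟨t, ht⟩ := hex
        rw [haltingSeq_of_haltsAt ht] at hd
        have h1 : (d + 1).factorial ≤ (d + t + 2).factorial := Nat.factorial_le (by omega)
        have h2 := Nat.factorial_pos (c + 1)
        omega
      · rw [haltingSeq_of_not_exists hex, Nat.cast_inj] at hd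
        have : d = c := by
          rcases lt_trichotomy d c with h | h | h
          · exact absurd hd ((Nat.factorial_lt d.succ_pos).2 (by omega)).ne
          · exact h
          · exact absurd hd ((Nat.factorial_lt c.succ_pos).2 (by omega)).ne'
        exact hex (this ▸ ⟨s, hs⟩)
  · exact fun h => Or.inr ⟨c, haltingSeq_of_not_exists h⟩

/-- A natural number congruent to `haltingSeq c` modulo `n + 1`, computed by searching for the
halting stage only up to `n`. -/
def haltingResidue (n c : ℕ) : ℕ :=
  if HaltsAt c (Nat.findGreatest (HaltsAt c) n) then
    (c + 1).factorial + n * (c + Nat.findGreatest (HaltsAt c) n + 2).factorial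
  else (c + 1).factorial

theorem primrec_haltingResidue : Primrec₂ haltingResidue := by
  have hc : Primrec fun p : ℕ × ℕ => (p.2 + 1).factorial :=
    primrec_factorial.comp (Primrec.succ.comp Primrec.snd)
  have hg : Primrec fun p : ℕ × ℕ => Nat.findGreatest (HaltsAt p.2) p.1 :=
    Primrec.nat_findGreatest (p := fun (p : ℕ × ℕ) s => HaltsAt p.2 s) Primrec.fst
      (primrecRel_haltsAt.comp₂ (Primrec.snd.comp Primrec.fst) Primrec.snd)
  exact Primrec.ite (primrecRel_haltsAt.comp Primrec.snd hg)
    (Primrec.nat_add.comp hc (Primrec.nat_mul.comp Primrec.fst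
      (primrec_factorial.comp (Primrec.nat_add.comp (Primrec.nat_add.comp Primrec.snd hg)
        (Primrec.const 2)))))
    hc

theorem haltingSeq_modEq (n c : ℕ) :
    haltingSeq c ≡ haltingResidue n c [ZMOD (n + 1 : ℕ)] := by
  rw [haltingResidue]
  split_ifs with h
  · rw [haltingSeq_of_haltsAt h, Int.modEq_iff_dvd]
    exact ⟨(c + Nat.findGreatest (HaltsAt c) n + 2).factorial, by push_cast; ring⟩
  · by_cases hex : ∃ s, HaltsAt c s
    · obtain ⟨s, hs⟩ := hex
      have hns : n < s := by
        by_contra hle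
        exact h (Nat.findGreatest_spec (not_lt.1 hle) hs)
      rw [haltingSeq_of_haltsAt hs, Int.modEq_iff_dvd, sub_sub_cancel]
      exact natCast_dvd_factorial n.succ_pos (by omega)
    · rw [haltingSeq_of_not_exists hex]

/-- There is a non-recursive subset of `ℤ`, closed in the profinite topology on `ℤ`,
for which `n ↦ (A mod n)` is computable. -/
theorem statement_3 :
    ∃ A : Set ℤ,
      ¬ ComputablePred (fun x : ℤ => x ∈ A) ∧
      ProfiniteClosed A ∧
      ModFunComputable A := by
  refine ⟨insert 0 (Set.range haltingSeq), fun h => ComputablePred.halting_problem 0 ?_,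
    profiniteClosed_insert_zero_range natCast_dvd_haltingSeq,
    modFunComputable_insert_zero_range primrec_haltingResidue natCast_dvd_haltingSeq
      haltingSeq_modEq⟩
  have hg : Computable fun c : Code => (((Encodable.encode c + 1).factorial : ℕ) : ℤ) :=
    (primrec_int_natCast.comp (primrec_factorial.comp
      (Primrec.succ.comp Primrec.encode))).to_comp
  refine (ComputablePred.computable_of_manyOneReducible ⟨_, hg, fun _ => Iff.rfl⟩ h).not.of_eq
    fun c => ?_
  rw [factorial_mem_iff, not_not, exists_haltsAt_iff, Denumerable.ofNat_encode]

end CFQ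
end
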